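/- arXiv:1908.05145 — 8 statements merged into one kernel-verified Lean document; each statement's English description precedes it below -/
import Mathlib

section
/- For any finite nonempty set S and any belief function bel : 𝒫(S) → [0,1], there exist a finite nonempty set S', a family 𝔸 ⊆ 𝒫(S') containing S' and closed under complements and binary unions, a map μ : 𝔸 → [0,1] with μ(S') = 1 and μ(b ∪ b') = μ(b) + μ(b') for all disjoint b, b' ∈ 𝔸, and an injective map h : 𝒫(S) → 𝒫(S') satisfying h(∅) = ∅, h(S) = S', h(X ∪ Y) = h(X) ∪ h(Y), h(X ∩ Y) = h(X) ∩ h(Y) and h(S ∖ X) = S' ∖ h(X) for all X, Y ⊆ S, such that bel(X) = μ_*(h(X)) for every X ⊆ S, where μ_*(Z) = max{μ(b) | b ∈ 𝔸, b ⊆ Z}. -/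
open scoped Classical in
/-- The Möbius transform of a set function on finite sets. -/
noncomputable def moebiusTransform {S : Type*} (f : Finset S → ℝ) (A : Finset S) : ℝ :=
  ∑ D ∈ A.powerset, (-1 : ℝ) ^ D.card * f (A \ D)

open scoped Classical in
theorem moebiusTransform_insert {S : Type*} (f : Finset S → ℝ) {a : S} {B : Finset S}
    (ha : a ∉ B) :
    moebiusTransform f (insert a B) =
      moebiusTransform (fun C => f (insert a C)) B - moebiusTransform f B := by
  unfold moebiusTransform
  rw [Finset.sum_powerset_insert ha, sub_eq_add_neg, ← Finset.sum_neg_distrib]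
  congr 1
  · refine Finset.sum_congr rfl fun D hD => ?_
    rw [Finset.insert_sdiff_of_notMem _ fun h => ha (Finset.mem_powerset.1 hD h)]
  · refine Finset.sum_congr rfl fun D hD => ?_
    have haD : a ∉ D := fun h => ha (Finset.mem_powerset.1 hD h)
    have hBD : insert a B \ insert a D = B \ D := by
      ext x
      simp only [Finset.mem_sdiff, Finset.mem_insert]
      grind
    rw [hBD, Finset.card_insert_of_notMem haD, pow_succ]
    ring

/-- Möbius inversion on the lattice of finite sets. -/
theorem sum_powerset_moebiusTransform {S : Type*} (f : Finset S → ℝ) (A : Finset S) :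
    ∑ B ∈ A.powerset, moebiusTransform f B = f A := by
  classical
  induction A using Finset.induction_on generalizing f with
  | empty => simp [moebiusTransform]
  | insert a A ha ih =>
    rw [Finset.sum_powerset_insert ha, ← Finset.sum_add_distrib,
      ← ih fun C => f (insert a C)]
    refine Finset.sum_congr rfl fun B hB => ?_
    rw [moebiusTransform_insert f fun h => ha (Finset.mem_powerset.1 hB h)]
    ring

/-- The Möbius transform of a totally monotone set function is nonnegative on nonempty sets. -/
theorem moebiusTransform_nonneg {S : Type*} (bel : Set S → ℝ)
    (h_nonneg : ∀ X : Set S, 0 ≤ bel X) (h_empty : bel ∅ = 0)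
    (h_super : ∀ n : ℕ, 1 ≤ n → ∀ A : Fin n → Set S,
      (∑ I ∈ Finset.univ.powerset.filter (fun I : Finset (Fin n) => I ≠ ∅),
        (-1 : ℝ) ^ (I.card + 1) * bel (⋂ i ∈ I, A i)) ≤ bel (⋃ i, A i))
    {A : Finset S} (hA : A.Nonempty) :
    0 ≤ moebiusTransform (fun B => bel B) A := by
  classical
  let e : Fin A.card ↪ S := A.equivFin.symm.toEmbedding.trans (Function.Embedding.subtype _)
  have he (i) : e i ∈ A := (A.equivFin.symm i).2
  have hmap : Finset.univ.map e = A := by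
    ext x
    simp only [Finset.mem_map, Finset.mem_univ, true_and]
    exact ⟨by rintro ⟨i, rfl⟩; exact he i, fun hx => ⟨A.equivFin ⟨x, hx⟩, by simp [e]⟩⟩
  have hsup := h_super A.card hA.card_pos fun i => (A : Set S) \ {e i}
  have hunion : bel (⋃ i, (A : Set S) \ {e i}) ≤ bel A := by
    by_cases hU : (⋃ i, (A : Set S) \ {e i}) = A
    · rw [hU]
    · have hE : (⋃ i, (A : Set S) \ {e i}) = ∅ := by
        by_contra hne
        obtain ⟨x, hx⟩ := Set.nonempty_iff_ne_empty.2 hne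
        obtain ⟨i, hxA, hxi⟩ := Set.mem_iUnion.1 hx
        refine hU (subset_antisymm (Set.iUnion_subset fun _ => Set.sdiff_subset) fun y hy => ?_)
        by_cases hyi : y = e i
        · obtain ⟨j, -, hj⟩ := Finset.mem_map.1 (hmap.symm ▸ Finset.mem_coe.1 hxA)
          refine Set.mem_iUnion.2 ⟨j, hy, fun h => hxi ?_⟩
          rw [Set.mem_singleton_iff] at h ⊢
          rw [← hj, ← h, hyi]
        · exact Set.mem_iUnion.2 ⟨i, hy, hyi⟩
      rw [hE, h_empty]
      exact h_nonneg _
  have hsum : moebiusTransform (fun B => bel B) A =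
      ∑ I : Finset (Fin A.card), (-1 : ℝ) ^ I.card * bel ↑(A \ I.map e) := by
    unfold moebiusTransform
    symm
    refine Finset.sum_bij (fun I _ => I.map e) ?_ ?_ ?_ ?_
    · intro I _
      exact Finset.mem_powerset.2
        ((Finset.map_subset_map.2 (Finset.subset_univ I)).trans hmap.subset)
    · intro I _ J _ h
      exact Finset.map_injective e h
    · intro D hD
      obtain ⟨I, -, rfl⟩ :=
        Finset.subset_map_iff.1 ((Finset.mem_powerset.1 hD).trans hmap.symm.subset)
      exact ⟨I, Finset.mem_univ _, rfl⟩
    · intro I _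
      simp only [Finset.card_map]
  have hsplit : ∑ I : Finset (Fin A.card), (-1 : ℝ) ^ I.card * bel ↑(A \ I.map e) =
      bel A - ∑ I ∈ Finset.univ.powerset.filter (fun I : Finset (Fin A.card) => I ≠ ∅),
        (-1 : ℝ) ^ (I.card + 1) * bel (⋂ i ∈ I, (A : Set S) \ {e i}) := by
    rw [← Finset.add_sum_erase _ _ (Finset.mem_univ (∅ : Finset (Fin A.card))), sub_eq_add_neg,
      ← Finset.sum_neg_distrib]
    congr 1
    · simp
    · refine Finset.sum_congr (by ext I; simp) fun I hI => ?_
      have hne : I.Nonempty := Finset.nonempty_iff_ne_empty.2 (Finset.mem_filter.1 hI).2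
      have hset : (↑(A \ I.map e) : Set S) = ⋂ i ∈ I, (A : Set S) \ {e i} := by
        obtain ⟨k, hk⟩ := hne
        ext x
        simp only [Finset.coe_sdiff, Finset.coe_map, Set.mem_sdiff, Finset.mem_coe, Set.mem_image,
          Set.mem_iInter, Set.mem_singleton_iff, not_exists, not_and]
        exact ⟨fun h i hi => ⟨h.1, fun hx => h.2 i hi hx.symm⟩,
          fun h => ⟨(h k hk).1, fun i hi hx => (h i hi).2 hx.symm⟩⟩
      rw [hset, pow_succ]
      ring
  rw [hsum, hsplit]
  linarith

/-- Every belief function on a finite nonempty set `S` can be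
represented as the inner measure of a finite probability space `(S', 𝔸, μ)`, via a
Boolean-algebra embedding `h : 𝒫(S) → 𝒫(S')`. -/
theorem belief_representation
    {S : Type} [Fintype S] [Nonempty S]
    (bel : Set S → ℝ)
    (h01 : ∀ X : Set S, 0 ≤ bel X ∧ bel X ≤ 1)
    (h_empty : bel ∅ = 0)
    (h_univ : bel Set.univ = 1)
    (h_super : ∀ n : ℕ, 1 ≤ n → ∀ A : Fin n → Set S,
      (∑ I ∈ Finset.univ.powerset.filter (fun I : Finset (Fin n) => I ≠ ∅),
        (-1 : ℝ) ^ (I.card + 1) * bel (⋂ i ∈ I, A i)) ≤ bel (⋃ i, A i)) :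
    ∃ (S' : Type) (_ : Fintype S') (_ : Nonempty S')
      (𝔸 : Set (Set S')) (μ : Set S' → ℝ) (h : Set S → Set S'),
      Set.univ ∈ 𝔸 ∧
      (∀ b ∈ 𝔸, bᶜ ∈ 𝔸) ∧
      (∀ b ∈ 𝔸, ∀ b' ∈ 𝔸, b ∪ b' ∈ 𝔸) ∧
      (∀ b ∈ 𝔸, 0 ≤ μ b ∧ μ b ≤ 1) ∧
      μ Set.univ = 1 ∧
      (∀ b ∈ 𝔸, ∀ b' ∈ 𝔸, Disjoint b b' → μ (b ∪ b') = μ b + μ b') ∧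
      Function.Injective h ∧
      h ∅ = ∅ ∧
      h Set.univ = Set.univ ∧
      (∀ X Y : Set S, h (X ∪ Y) = h X ∪ h Y) ∧
      (∀ X Y : Set S, h (X ∩ Y) = h X ∩ h Y) ∧
      (∀ X : Set S, h (Set.univ \ X) = Set.univ \ h X) ∧
      (∀ X : Set S, bel X = sSup {r : ℝ | ∃ b ∈ 𝔸, b ⊆ h X ∧ μ b = r}) := by
  classical
  let m : Finset S → ℝ := moebiusTransform fun B => bel B
  have hm0 : m ∅ = 0 := by simp [m, moebiusTransform, h_empty]
  have hm (B : Finset S) : 0 ≤ m B := by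
    rcases B.eq_empty_or_nonempty with rfl | hB
    · exact hm0.ge
    · exact moebiusTransform_nonneg bel (fun X => (h01 X).1) h_empty h_super hB
  have hbel (X : Set S) : ∑ B : Finset S, (if (B : Set S) ⊆ X then m B else 0) = bel X := by
    have h := sum_powerset_moebiusTransform (fun B : Finset S => bel B) X.toFinset
    simp only [Set.coe_toFinset] at h
    rw [← h, ← Finset.sum_filter]
    refine Finset.sum_congr ?_ fun _ _ => rfl
    ext B
    simp [← Finset.coe_subset]
  let S' := {p : Finset S × S // p.2 ∈ p.1}
  let μ : Set S' → ℝ := fun b => ∑ B : Finset S, if ∃ p ∈ b, p.1.1 = B then m B else 0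
  let 𝔸 : Set (Set S') := {b | ∀ p q : S', p.1.1 = q.1.1 → p ∈ b → q ∈ b}
  let h : Set S → Set S' := fun X => {p | p.1.2 ∈ X}
  have hμ0 (b) : 0 ≤ μ b := Finset.sum_nonneg fun B _ => by
    split_ifs
    exacts [hm B, le_rfl]
  have hμle (X : Set S) (b) (hb : b ∈ 𝔸) (hbX : b ⊆ h X) : μ b ≤ bel X := by
    rw [← hbel X]
    refine Finset.sum_le_sum fun B _ => ?_
    by_cases hB : ∃ p ∈ b, p.1.1 = B
    · obtain ⟨p, hp, rfl⟩ := id hB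
      have hsub : (p.1.1 : Set S) ⊆ X := fun x hx => hbX (hb p ⟨(p.1.1, x), hx⟩ rfl hp)
      rw [if_pos hB, if_pos hsub]
    · rw [if_neg hB]
      split_ifs
      exacts [hm B, le_rfl]
  have hμeq (X : Set S) : μ {p | (p.1.1 : Set S) ⊆ X} = bel X := by
    rw [← hbel X]
    refine Finset.sum_congr rfl fun B _ => ?_
    rcases B.eq_empty_or_nonempty with rfl | ⟨x, hx⟩
    · simp [hm0]
    · refine if_congr ⟨?_, fun hBX => ⟨⟨(B, x), hx⟩, hBX, rfl⟩⟩ rfl rfl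
      rintro ⟨p, hp, rfl⟩
      exact hp
  obtain ⟨s⟩ := ‹Nonempty S›
  refine ⟨S', inferInstance, ⟨⟨({s}, s), by simp⟩⟩, 𝔸, μ, h, fun _ _ _ _ => trivial,
    fun b hb p q hpq hp hq => hp (hb q p hpq.symm hq), ?_, fun b hb => ⟨hμ0 b, ?_⟩, ?_, ?_, ?_,
    rfl, rfl, fun _ _ => rfl, fun _ _ => rfl, fun _ => rfl, fun X => ?_⟩
  · intro b hb b' hb' p q hpq hp
    exact hp.imp (hb p q hpq) (hb' p q hpq)
  · exact h_univ ▸ hμle Set.univ b hb fun _ _ => trivial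
  · simpa [h_univ] using hμeq Set.univ
  · intro b hb b' hb' hd
    rw [← Finset.sum_add_distrib]
    refine Finset.sum_congr rfl fun B _ => ?_
    have hnot : ¬((∃ p ∈ b, p.1.1 = B) ∧ ∃ p ∈ b', p.1.1 = B) := by
      rintro ⟨⟨p, hp, hpB⟩, q, hq, hqB⟩
      exact Set.disjoint_left.1 hd (hb p q (hpB.trans hqB.symm) hp) hq
    have hor : (∃ p ∈ b ∪ b', p.1.1 = B) ↔
        (∃ p ∈ b, p.1.1 = B) ∨ ∃ p ∈ b', p.1.1 = B := by
      simp only [Set.mem_union, or_and_right, exists_or]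
    simp only [hor]
    by_cases h₁ : ∃ p ∈ b, p.1.1 = B <;> by_cases h₂ : ∃ p ∈ b', p.1.1 = B
    · exact absurd ⟨h₁, h₂⟩ hnot
    · rw [if_pos (Or.inl h₁), if_pos h₁, if_neg h₂, add_zero]
    · rw [if_pos (Or.inr h₂), if_neg h₁, if_pos h₂, zero_add]
    · rw [if_neg (not_or.2 ⟨h₁, h₂⟩), if_neg h₁, if_neg h₂, add_zero]
  · intro X Y hXY
    ext x
    let p : S' := ⟨({x}, x), Finset.mem_singleton_self x⟩
    have hp : p ∈ h X ↔ p ∈ h Y := by rw [hXY]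
    exact hp
  · have hmem : {p : S' | (p.1.1 : Set S) ⊆ X} ∈ 𝔸 := fun p q hpq hp => by
      simpa [← hpq] using hp
    have hmax : IsGreatest {r : ℝ | ∃ b ∈ 𝔸, b ⊆ h X ∧ μ b = r} (bel X) := by
      refine ⟨⟨_, hmem, fun p hp => hp p.2, hμeq X⟩, ?_⟩
      rintro _ ⟨b, hb, hbX, rfl⟩
      exact hμle X b hb hbX
    exact hmax.csSup_eq.symm
end

section
/- Let P = (A, X, I) be a formal context whose concept lattice P⁺ is finite, and let m be a mass function on P. Then there exist a formal context P' = (A', X', I') with finite concept lattice P'⁺, a finite Boolean algebra 𝔸, an injective lattice homomorphism e : 𝔸 → P'⁺ (preserving binary meets and joins and mapping ⊥ to ⊥ and ⊤ to ⊤), a map μ : 𝔸 → [0,1] with μ(⊤) = 1, μ(⊥) = 0 and μ(a ⊔ b) = μ(a) + μ(b) whenever a ⊓ b = ⊥, and an injective meet-preserving map h : P⁺ → P'⁺, such that for every c ∈ P⁺: bel_m(c) = μ(⋁{a ∈ 𝔸 | e(a) ≤ h(c)}) and pl_m(c) = μ(⋀{a ∈ 𝔸 | h(c) ≤ e(a)}).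 -/
open scoped Classical

namespace DS

variable {A X : Type}

/-- Upper derivation operator of a formal context. -/
def up (I : A → X → Prop) (B : Set A) : Set X := {x | ∀ a ∈ B, I a x}

/-- Lower derivation operator of a formal context. -/
def dn (I : A → X → Prop) (Y : Set X) : Set A := {a | ∀ x ∈ Y, I a x}

/-- A formal concept of the formal context `(A, X, I)`. -/
structure Concept (I : A → X → Prop) where
  ext : Set A
  int : Set X
  up_ext : up I ext = int
  dn_int : dn I int = ext

theorem Concept.ext_inj {I : A → X → Prop} :
    Function.Injective (Concept.ext (I := I)) := by
  rintro ⟨e1, i1, h1, h2⟩ ⟨e2, i2, h3, h4⟩ h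
  obtain rfl : e1 = e2 := h
  obtain rfl : i1 = i2 := h1.symm.trans h3
  rfl

instance {I : A → X → Prop} : PartialOrder (Concept I) :=
  PartialOrder.lift Concept.ext Concept.ext_inj

theorem subset_dn_up (I : A → X → Prop) (B : Set A) : B ⊆ dn I (up I B) :=
  fun a ha _x hx => hx a ha

theorem subset_up_dn (I : A → X → Prop) (Y : Set X) : Y ⊆ up I (dn I Y) :=
  fun x hx _a ha => ha x hx

theorem dn_anti (I : A → X → Prop) {Y₁ Y₂ : Set X} (h : Y₁ ⊆ Y₂) : dn I Y₂ ⊆ dn I Y₁ :=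
  fun a ha x hx => ha x (h hx)

theorem dn_up_dn (I : A → X → Prop) (Y : Set X) : dn I (up I (dn I Y)) = dn I Y :=
  Set.Subset.antisymm (dn_anti I (subset_up_dn I Y)) (subset_dn_up I (dn I Y))

theorem dn_union (I : A → X → Prop) (Y₁ Y₂ : Set X) :
    dn I (Y₁ ∪ Y₂) = dn I Y₁ ∩ dn I Y₂ := by
  ext a
  simp [dn, or_imp, forall_and]

/-- The meet of two formal concepts: its extent is the intersection of the extents. -/
def Concept.inf {I : A → X → Prop} (c d : Concept I) : Concept I where
  ext := c.ext ∩ d.ext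
  int := up I (c.ext ∩ d.ext)
  up_ext := rfl
  dn_int := by
    have h : c.ext ∩ d.ext = dn I (c.int ∪ d.int) := by
      rw [dn_union, c.dn_int, d.dn_int]
    rw [h, dn_up_dn]

/-- The top concept: its extent is all of `A`. -/
def Concept.top (I : A → X → Prop) : Concept I where
  ext := Set.univ
  int := up I Set.univ
  up_ext := rfl
  dn_int := Set.eq_univ_of_forall (fun a x hx => hx a (Set.mem_univ a))

/-- The bottom concept: its extent is `X^↓`. -/
def Concept.bot (I : A → X → Prop) : Concept I where
  ext := dn I Set.univ
  int := up I (dn I Set.univ)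
  up_ext := rfl
  dn_int := dn_up_dn I Set.univ

/-- A mass function on a formal context with finite concept lattice. -/
def IsMass {I : A → X → Prop} [Fintype (Concept I)] (m : Concept I → ℝ) : Prop :=
  (∀ c, 0 ≤ m c ∧ m c ≤ 1) ∧ (∑ c : Concept I, m c = 1) ∧
    ((Concept.bot I).ext = ∅ → m (Concept.bot I) = 0)

/-- The Dempster–Shafer combination of two mass functions on a formal context. -/
noncomputable def combine {I : A → X → Prop} [Fintype (Concept I)]
    (m₁ m₂ : Concept I → ℝ) (c : Concept I) : ℝ :=
  if c.ext = ∅ then 0 else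
    (∑ c₁ : Concept I, ∑ c₂ : Concept I, if Concept.inf c₁ c₂ = c then m₁ c₁ * m₂ c₂ else 0) /
    (∑ c₁ : Concept I, ∑ c₂ : Concept I,
      if (Concept.inf c₁ c₂).ext ≠ ∅ then m₁ c₁ * m₂ c₂ else 0)

end DS

open DS

namespace DS

/-- The body of the representation theorem: there are an embedding `e` of the finite
Boolean algebra `𝔸` into the concept lattice of `I₂` (preserving meets, joins, `⊥`, `⊤`),
a finitely additive probability measure `μ` on `𝔸`, and an injective meet-preserving map
`h` from the concepts of `I` to those of `I₂`, such that for every concept `c` of `I`,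
`bel_m(c) = μ(⋁{a | e a ≤ h c}) = μ_*(h c)` and `pl_m(c) = μ(⋀{a | h c ≤ e a}) = μ^*(h c)`. -/
def IsDSRepresentation {A X A₂ X₂ : Type} (I : A → X → Prop) [Fintype (Concept I)]
    (m : Concept I → ℝ) (I₂ : A₂ → X₂ → Prop) (𝔸 : Type)
    (inst : CompleteBooleanAlgebra 𝔸) : Prop :=
  letI := inst
  ∃ (e : 𝔸 → Concept I₂) (μ : 𝔸 → ℝ) (h : Concept I → Concept I₂),
    Function.Injective e ∧
    (∀ a b : 𝔸, (e (a ⊓ b)).ext = (e a).ext ∩ (e b).ext) ∧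
    (∀ a b : 𝔸, (e (a ⊔ b)).int = (e a).int ∩ (e b).int) ∧
    (e ⊥).int = Set.univ ∧
    (e ⊤).ext = Set.univ ∧
    (∀ a : 𝔸, 0 ≤ μ a ∧ μ a ≤ 1) ∧
    μ ⊤ = 1 ∧
    μ ⊥ = 0 ∧
    (∀ a b : 𝔸, a ⊓ b = ⊥ → μ (a ⊔ b) = μ a + μ b) ∧
    Function.Injective h ∧
    (∀ c d : Concept I, h (Concept.inf c d) = Concept.inf (h c) (h d)) ∧
    (∀ c : Concept I,
      (∑ c' : Concept I, if c' ≤ c then m c' else 0) = μ (sSup {a : 𝔸 | e a ≤ h c}) ∧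
      (∑ c' : Concept I, if (Concept.inf c' c).ext ≠ ∅ then m c' else 0) =
        μ (sInf {a : 𝔸 | h c ≤ e a}))

end DS

namespace DS

section PowersetContext

variable {W : Type}

/-- Every subset of `W` is the extent of a concept of the context `(W, W, ≠)`. -/
def Concept.ofSet (S : Set W) : Concept (fun a b : W => a ≠ b) where
  ext := S
  int := Sᶜ
  up_ext := by
    ext x
    exact ⟨fun h hx => h x hx rfl, fun h a ha hax => h (hax ▸ ha)⟩
  dn_int := by
    ext a
    exact ⟨fun h => by_contra fun ha => h a ha rfl, fun ha x hx hax => hx (hax ▸ ha)⟩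

theorem Concept.ofSet_injective : Function.Injective (Concept.ofSet (W := W)) :=
  fun _ _ h => congrArg Concept.ext h

theorem Concept.ofSet_le_ofSet {S T : Set W} :
    Concept.ofSet S ≤ Concept.ofSet T ↔ S ⊆ T :=
  Iff.rfl

end PowersetContext

variable {A X : Type} {I : A → X → Prop}

theorem Concept.eq_bot_of_ext_eq_empty {c : Concept I} (hc : c.ext = ∅) :
    c = Concept.bot I := by
  apply Concept.ext_inj
  have h : (Concept.bot I).ext ⊆ c.ext := c.dn_int ▸ dn_anti I (Set.subset_univ c.int)
  rw [hc] at h ⊢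
  exact (Set.subset_empty_iff.mp h).symm

theorem IsMass.eq_zero_of_ext_eq_empty [Fintype (Concept I)] {m : Concept I → ℝ}
    (hm : IsMass m) {c : Concept I} (hc : c.ext = ∅) : m c = 0 := by
  obtain rfl := Concept.eq_bot_of_ext_eq_empty hc
  exact hm.2.2 hc

/-- The concepts containing the object `a`. -/
def conceptsAt (I : A → X → Prop) (a : A) : Set (Concept I) := {c | a ∈ c.ext}

/-- The concepts with nonempty extent. -/
abbrev NonemptyConcept (I : A → X → Prop) : Type := {c : Concept I // c.ext.Nonempty}

/-- A concept together with an object of its extent, where objects lying in the same concepts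
are identified. -/
abbrev PointedConcept (I : A → X → Prop) : Type :=
  {p : NonemptyConcept I × Set (Concept I) // ∃ a ∈ p.1.1.ext, p.2 = conceptsAt I a}

/-- The pointed concept given by `a ∈ ⟦c⟧`. -/
def PointedConcept.mk (c : Concept I) (a : A) (ha : a ∈ c.ext) : PointedConcept I :=
  ⟨(⟨c, a, ha⟩, conceptsAt I a), a, ha, rfl⟩

theorem PointedConcept.exists_eq_mk (p : PointedConcept I) :
    ∃ (c : Concept I) (a : A) (ha : a ∈ c.ext), p = PointedConcept.mk c a ha := by
  obtain ⟨⟨k, T⟩, a, ha, hT⟩ := p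
  exact ⟨k.1, a, ha, Subtype.ext (Prod.ext rfl hT)⟩

/-- The pointed concepts whose concept lies in `S`. -/
def pointsOver (S : Set (NonemptyConcept I)) : Set (PointedConcept I) := {p | p.1.1 ∈ S}

/-- The pointed concepts whose object lies in `c`. -/
def pointsIn (c : Concept I) : Set (PointedConcept I) := {p | c ∈ p.1.2}

theorem pointsOver_injective : Function.Injective (pointsOver (I := I)) := by
  intro S T h
  ext ⟨c, a, ha⟩
  exact Set.ext_iff.mp h (PointedConcept.mk c a ha)

theorem pointsIn_injective : Function.Injective (pointsIn (I := I)) := by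
  have key : ∀ {c d : Concept I}, pointsIn c ⊆ pointsIn d → c.ext ⊆ d.ext :=
    fun {c _} h a ha => @h (PointedConcept.mk c a ha) ha
  exact fun c d h => Concept.ext_inj (Set.Subset.antisymm (key h.le) (key h.ge))

theorem pointsIn_inf (c d : Concept I) :
    pointsIn (Concept.inf c d) = pointsIn c ∩ pointsIn d := by
  ext p
  obtain ⟨k, a, ha, rfl⟩ := p.exists_eq_mk
  exact Iff.rfl

theorem pointsOver_subset_pointsIn {S : Set (NonemptyConcept I)} {c : Concept I} :
    pointsOver S ⊆ pointsIn c ↔ ∀ k ∈ S, k.1 ≤ c := by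
  constructor
  · intro h k hk a ha
    exact @h (PointedConcept.mk k.1 a ha) hk
  · intro h p hp
    obtain ⟨k, a, ha, rfl⟩ := p.exists_eq_mk
    exact h _ hp ha

theorem pointsIn_subset_pointsOver {S : Set (NonemptyConcept I)} {c : Concept I} :
    pointsIn c ⊆ pointsOver S ↔
      ∀ k : NonemptyConcept I, (Concept.inf k.1 c).ext ≠ ∅ → k ∈ S := by
  constructor
  · intro h k hk
    obtain ⟨a, ha, hac⟩ := Set.nonempty_iff_ne_empty.mpr hk
    exact @h (PointedConcept.mk k.1 a ha) hac
  · intro h p hac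
    obtain ⟨k, a, ha, rfl⟩ := p.exists_eq_mk
    exact h _ (Set.nonempty_iff_ne_empty.mp ⟨a, ha, hac⟩)

theorem sSup_pointsOver_subset (c : Concept I) :
    sSup {S : Set (NonemptyConcept I) | pointsOver S ⊆ pointsIn c} = {k | k.1 ≤ c} := by
  simp only [pointsOver_subset_pointsIn]
  exact IsLUB.sSup_eq ⟨fun S hS => hS, fun T hT => hT fun _ hk => hk⟩

theorem sInf_subset_pointsOver (c : Concept I) :
    sInf {S : Set (NonemptyConcept I) | pointsIn c ⊆ pointsOver S} =
      {k | (Concept.inf k.1 c).ext ≠ ∅} := by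
  simp only [pointsIn_subset_pointsOver]
  exact IsGLB.sInf_eq ⟨fun S hS => hS, fun T hT => hT fun _ hk => hk⟩

/-- The additive set function on nonempty concepts with point masses `m`. -/
noncomputable def massMeasure [Fintype (Concept I)] (m : Concept I → ℝ)
    (S : Set (NonemptyConcept I)) : ℝ :=
  ∑ c : Concept I, if ∃ h : c.ext.Nonempty, (⟨c, h⟩ : NonemptyConcept I) ∈ S then m c else 0

theorem massMeasure_setOf [Fintype (Concept I)] {m : Concept I → ℝ} (hm : IsMass m)
    (p : Concept I → Prop) [DecidablePred p] :
    massMeasure m {k | p k.1} = ∑ c : Concept I, if p c then m c else 0 := by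
  refine Finset.sum_congr rfl fun c _ => ?_
  rcases Set.eq_empty_or_nonempty c.ext with hc | hc
  · simp [hm.eq_zero_of_ext_eq_empty hc]
  · simp [hc]

theorem massMeasure_univ [Fintype (Concept I)] {m : Concept I → ℝ} (hm : IsMass m) :
    massMeasure m Set.univ = 1 := by
  simpa [hm.2.1] using massMeasure_setOf hm fun _ => True

theorem massMeasure_nonneg [Fintype (Concept I)] {m : Concept I → ℝ} (hm : IsMass m)
    (S : Set (NonemptyConcept I)) : 0 ≤ massMeasure m S :=
  Finset.sum_nonneg fun c _ => by
    split_ifs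
    exacts [(hm.1 c).1, le_rfl]

theorem massMeasure_le_one [Fintype (Concept I)] {m : Concept I → ℝ} (hm : IsMass m)
    (S : Set (NonemptyConcept I)) : massMeasure m S ≤ 1 := by
  rw [← hm.2.1]
  refine Finset.sum_le_sum fun c _ => ?_
  split_ifs
  exacts [le_rfl, (hm.1 c).1]

theorem massMeasure_union [Fintype (Concept I)] (m : Concept I → ℝ)
    {S T : Set (NonemptyConcept I)} (h : Disjoint S T) :
    massMeasure m (S ∪ T) = massMeasure m S + massMeasure m T := by
  rw [massMeasure, massMeasure, massMeasure, ← Finset.sum_add_distrib]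
  refine Finset.sum_congr rfl fun c _ => ?_
  by_cases hc : c.ext.Nonempty
  · by_cases hS : (⟨c, hc⟩ : NonemptyConcept I) ∈ S
    · simp [hc, hS, Set.disjoint_left.mp h hS]
    · simp [hc, hS]
  · simp [hc]

end DS

/-- (Representation of conceptual DS-structures as conceptual probability
spaces.) For every formal context `P = (A, X, I)` with finite concept lattice and every
mass function `m` on it, there exist a formal context `P' = (A₂, X₂, I₂)` with finite
concept lattice, a finite (complete) Boolean algebra `𝔸` embedded into `P'⁺` by a lattice
homomorphism `e`, a finitely additive probability measure `μ : 𝔸 → [0,1]`, and an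
injective meet-preserving `h : P⁺ → P'⁺` such that `bel_m(c) = μ_*(h c)` and
`pl_m(c) = μ^*(h c)` for every concept `c` of `P`. -/
theorem conceptual_DS_representation
    {A X : Type} (I : A → X → Prop) [Fintype (Concept I)]
    (m : Concept I → ℝ) (hm : IsMass m) :
    ∃ (A₂ X₂ : Type) (I₂ : A₂ → X₂ → Prop) (_ : Fintype (Concept I₂))
      (𝔸 : Type) (inst : CompleteBooleanAlgebra 𝔸) (_ : Finite 𝔸),
      IsDSRepresentation I m I₂ 𝔸 inst := by
  have : Finite (Concept fun a b : PointedConcept I => a ≠ b) :=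
    Finite.of_injective _ Concept.ext_inj
  refine ⟨PointedConcept I, PointedConcept I, fun a b => a ≠ b, Fintype.ofFinite _,
    Set (NonemptyConcept I), inferInstance, inferInstance,
    fun S => Concept.ofSet (pointsOver S), massMeasure m, fun c => Concept.ofSet (pointsIn c),
    Concept.ofSet_injective.comp pointsOver_injective, fun _ _ => rfl,
    fun _ _ => Set.compl_union _ _, Set.compl_empty, rfl,
    fun S => ⟨massMeasure_nonneg hm S, massMeasure_le_one hm S⟩, massMeasure_univ hm, ?_,
    fun _ _ h => massMeasure_union m (disjoint_iff.mpr h),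
    Concept.ofSet_injective.comp pointsIn_injective,
    fun c d => Concept.ext_inj (pointsIn_inf c d), fun c => ⟨?_, ?_⟩⟩
  · simp [massMeasure]
  · simp only [Concept.ofSet_le_ofSet, sSup_pointsOver_subset]
    exact (massMeasure_setOf hm fun k => k ≤ c).symm
  · simp only [Concept.ofSet_le_ofSet, sInf_subset_pointsOver]
    exact (massMeasure_setOf hm fun k => (Concept.inf k c).ext ≠ ∅).symm
end

section
/- Let S be a finite set and let m : 𝒫(S) → [0,1] satisfy m(∅) = 0 and ∑_{X ⊆ S} m(X) = 1, and define bel_m(X) = ∑_{Y ⊆ X} m(Y). Then bel_m(∅) = 0, bel_m(S) = 1, and for every n ≥ 1 and all A₁, …, Aₙ ⊆ S: bel_m(A₁ ∪ ⋯ ∪ Aₙ) ≥ ∑_{∅ ≠ I ⊆ {1,…,n}} (−1)^{|I|+1} bel_m(⋂_{i ∈ I} Aᵢ); that is, bel_m is a belief function on S. -/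
open scoped Classical

/-- The signed count of the nonempty subsets of a finite set `J` is `1`, unless `J` is empty. -/
theorem Finset.sum_nonempty_powerset_neg_one_pow_card_succ {ι : Type*} [DecidableEq ι]
    (J : Finset ι) :
    ∑ I ∈ J.powerset.filter (· ≠ ∅), (-1 : ℝ) ^ (I.card + 1) = if J = ∅ then 0 else 1 := by
  have h : ∑ I ∈ J.powerset, (-1 : ℝ) ^ I.card = if J = ∅ then 1 else 0 := by
    exact_mod_cast congrArg (Int.cast : ℤ → ℝ) (Finset.sum_powerset_neg_one_pow_card (x := J))
  rw [Finset.filter_ne', ← Finset.add_sum_erase _ _ (Finset.empty_mem_powerset J)] at *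
  simp only [pow_succ, mul_neg, mul_one, Finset.sum_neg_distrib, Finset.card_empty, pow_zero] at *
  split_ifs at * <;> linarith

/-- The belief function `bel_m(X) = ∑_{Y ⊆ X} m(Y)` induced by a mass
function `m` on a finite set `S` is a belief function: `bel_m(∅) = 0`, `bel_m(S) = 1`,
and `bel_m` is ∞-monotone (superadditive in the inclusion–exclusion sense). -/
theorem belOfMass_isBelief
    {S : Type} [Fintype S]
    (m : Set S → ℝ)
    (hm01 : ∀ X : Set S, 0 ≤ m X ∧ m X ≤ 1)
    (hm_empty : m ∅ = 0)
    (hm_sum : ∑ X : Set S, m X = 1)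
    (bel : Set S → ℝ)
    (hbel : ∀ X : Set S, bel X = ∑ Y : Set S, if Y ⊆ X then m Y else 0) :
    bel ∅ = 0 ∧ bel Set.univ = 1 ∧
    (∀ n : ℕ, 1 ≤ n → ∀ A : Fin n → Set S,
      (∑ I ∈ Finset.univ.powerset.filter (fun I : Finset (Fin n) => I ≠ ∅),
        (-1 : ℝ) ^ (I.card + 1) * bel (⋂ i ∈ I, A i)) ≤ bel (⋃ i, A i)) := by
  refine ⟨?_, ?_, fun n _ A => ?_⟩
  · simp [hbel, Set.subset_empty_iff, hm_empty]
  · simp [hbel, hm_sum]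
  have expand : ∑ I ∈ Finset.univ.powerset.filter (fun I : Finset (Fin n) => I ≠ ∅),
      (-1 : ℝ) ^ (I.card + 1) * bel (⋂ i ∈ I, A i) =
      ∑ Y : Set S, if ∃ i, Y ⊆ A i then m Y else 0 := by
    simp only [hbel, Finset.mul_sum]
    rw [Finset.sum_comm]
    refine Finset.sum_congr rfl fun Y _ => ?_
    set J : Finset (Fin n) := Finset.univ.filter fun i => Y ⊆ A i with hJ
    have key := Finset.sum_nonempty_powerset_neg_one_pow_card_succ J
    have hsub (I : Finset (Fin n)) : Y ⊆ ⋂ i ∈ I, A i ↔ I ⊆ J := by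
      simp [hJ, Finset.subset_iff]
    have hex : (∃ i, Y ⊆ A i) ↔ J ≠ ∅ := by
      simp [hJ, Finset.filter_eq_empty_iff]
    simp only [hsub, hex, mul_ite, mul_zero]
    rw [← Finset.sum_filter, ← Finset.sum_mul]
    calc
      _ = (if J = ∅ then (0 : ℝ) else 1) * m Y := by
        refine congrArg (· * m Y) (Eq.trans (Finset.sum_congr ?_ fun _ _ => rfl) key)
        ext I
        simp [and_comm]
      _ = _ := by by_cases h : J = ∅ <;> simp [h]
  rw [expand, hbel]
  refine Finset.sum_le_sum fun Y _ => ?_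
  by_cases h : ∃ i, Y ⊆ A i
  · obtain ⟨i, hi⟩ := h
    rw [if_pos ⟨i, hi⟩, if_pos (hi.trans (Set.subset_iUnion A i))]
  · rw [if_neg h]
    split_ifs
    exacts [(hm01 Y).1, le_rfl]
end

section
/- Let P = (A, X, I) be a formal context with A and X finite and X^↓ = ∅, and let P' = (A', X', I') be defined by A' = {(c,a) | c ∈ P⁺, a ∈ ⟦c⟧}, X' = P⁺ × X, and (c,a) I' (d,x) iff c ≠ d or (a,x) ∈ I. Then for every concept c ∈ P⁺, the set E_c = {(c,a) | a ∈ ⟦c⟧} ⊆ A' is Galois-closed in P', i.e. E_c^{↑↓} = E_c; hence E_c is the extension of a formal concept c* of P'. -/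
open scoped Classical

namespace DS

variable {A X : Type}

/-- The set of objects of the auxiliary context `P'`:
pairs `(c, a)` with `c` a concept and `a ∈ ⟦c⟧`. -/
def CtxA' (I : A → X → Prop) : Type := {p : Concept I × A // p.2 ∈ p.1.ext}

/-- The set of features of the auxiliary context `P'`: pairs `(c, x)`. -/
def CtxX' (I : A → X → Prop) : Type := Concept I × X

/-- The incidence relation of the auxiliary context `P'`:
`(c,a) I' (d,x)` iff `c ≠ d` or `a I x`. -/
def CtxI' (I : A → X → Prop) : CtxA' I → CtxX' I → Prop :=
  fun p q => p.1.1 ≠ q.1 ∨ I p.1.2 q.2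

/-- `E c = {(c,a) | a ∈ ⟦c⟧} ⊆ A'`. -/
def E {I : A → X → Prop} (c : Concept I) : Set (CtxA' I) := {p | p.1.1 = c}

/-- `H c = {(d,a) ∈ A' | a ∈ ⟦c⟧}`. -/
def H {I : A → X → Prop} (c : Concept I) : Set (CtxA' I) := {p | p.1.2 ∈ c.ext}

end DS

open DS

/-- For every concept `c` of `P`, the set `E_c = {(c,a) | a ∈ ⟦c⟧}` is
Galois-closed in the auxiliary context `P'`, hence is the extension of a concept of `P'`. -/
theorem E_galois_closed
    {A X : Type} [Finite A] [Finite X] (I : A → X → Prop)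
    (hX : dn I Set.univ = ∅) :
    ∀ c : Concept I, dn (CtxI' I) (up (CtxI' I) (E c)) = E c := by
  intro c
  refine Set.Subset.antisymm (fun p hp => ?_) (subset_dn_up _ _)
  by_contra hpc
  have ha : p.1.2 ∈ dn I Set.univ := fun x _ =>
    (hp (p.1.1, x) fun q hq => Or.inl fun h => hpc (h.symm.trans hq)).resolve_left
      fun h => h rfl
  exact Set.notMem_empty _ (hX ▸ ha)
end

section
/- Let P = (A, X, I) be a formal context with A and X finite and X^↓ = ∅, and let P' = (A', X', I') be defined by A' = {(c,a) | c ∈ P⁺, a ∈ ⟦c⟧}, X' = P⁺ × X, and (c,a) I' (d,x) iff c ≠ d or (a,x) ∈ I. Then for every set U ⊆ P⁺ of concepts, the union ⋃_{c ∈ U} E_c, where E_c = {(c,a) | a ∈ ⟦c⟧}, is Galois-closed in P': (⋃_{c ∈ U} E_c)^{↑↓} = ⋃_{c ∈ U} E_c. -/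
open scoped Classical

open DS

/-- For every set `U` of concepts of `P`, the union `⋃_{c ∈ U} E_c`
is Galois-closed in the auxiliary context `P'`. -/
theorem union_E_galois_closed
    {A X : Type} [Finite A] [Finite X] (I : A → X → Prop)
    (hX : dn I Set.univ = ∅) :
    ∀ U : Set (Concept I),
      dn (CtxI' I) (up (CtxI' I) (⋃ c ∈ U, E c)) = ⋃ c ∈ U, E c := by
  intro U
  refine Set.Subset.antisymm (fun p hp => ?_) (subset_dn_up _ _)
  by_contra hpU
  have hpE : p.1.1 ∉ U := fun hU => hpU (Set.mem_biUnion hU rfl)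
  have hall : p.1.2 ∈ dn I Set.univ := fun x _ =>
    (hp (p.1.1, x) fun q hq => by
      obtain ⟨c, hc, rfl⟩ := Set.mem_iUnion₂.mp hq
      exact Or.inl fun h => hpE (h ▸ hc)).resolve_left (not_not_intro rfl)
  rw [hX] at hall
  exact hall
end

section
/- Let P = (A, X, I) be a formal context with A and X finite and X^↓ = ∅, and let P' = (A', X', I') be defined by A' = {(c,a) | c ∈ P⁺, a ∈ ⟦c⟧}, X' = P⁺ × X, and (c,a) I' (d,x) iff c ≠ d or (a,x) ∈ I. Then for every concept c ∈ P⁺: {(e,x) ∈ X' | x ∈ (⟦e⟧ ∩ ⟦c⟧)^↑}^↓ ⊆ {(d,a) ∈ A' | a ∈ ⟦c⟧}. -/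
open scoped Classical

open DS

/-- For every concept `c` of `P`:
`{(e,x) ∈ X' | x ∈ (⟦e⟧ ∩ ⟦c⟧)^↑}^↓ ⊆ {(d,a) ∈ A' | a ∈ ⟦c⟧}` in the auxiliary context `P'`. -/
theorem dn_subset_H
    {A X : Type} [Finite A] [Finite X] (I : A → X → Prop)
    (hX : dn I Set.univ = ∅) :
    ∀ c : Concept I,
      dn (CtxI' I) {q : CtxX' I | q.2 ∈ up I (q.1.ext ∩ c.ext)} ⊆ H c := by
  intro c p hp
  have hmem : p.1.2 ∈ dn I (up I (p.1.1.ext ∩ c.ext)) := fun x hx =>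
    (hp (p.1.1, x) hx).resolve_left (not_not_intro rfl)
  exact ((p.1.1.inf c).dn_int.subset hmem).2
end

section
/- Let P = (A, X, I) be a formal context with A and X finite and X^↓ = ∅, and let P' = (A', X', I') be defined by A' = {(c,a) | c ∈ P⁺, a ∈ ⟦c⟧}, X' = P⁺ × X, and (c,a) I' (d,x) iff c ≠ d or (a,x) ∈ I. For c ∈ P⁺ let H_c = {(d,a) ∈ A' | a ∈ ⟦c⟧}. Then each H_c is Galois-closed in P' (so it is the extension of a concept h(c) ∈ P'⁺), the assignment c ↦ h(c) is injective, and H_c ∩ H_d = H_{c ∧ d} for all c, d ∈ P⁺; hence h : P⁺ → P'⁺ is a meet-preserving embedding. -/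
open scoped Classical

open DS

/-- Each `H_c = {(d,a) ∈ A' | a ∈ ⟦c⟧}` is Galois-closed in the auxiliary
context `P'` (hence the extension of a concept `h c` of `P'`), the assignment `c ↦ h c` is
injective, and `H_c ∩ H_d = H_{c ∧ d}`; hence `h` is a meet-preserving embedding of `P⁺`
into `P'⁺`. -/
theorem H_meet_preserving_embedding
    {A X : Type} [Finite A] [Finite X] (I : A → X → Prop)
    (hX : dn I Set.univ = ∅) :
    (∀ c : Concept I, dn (CtxI' I) (up (CtxI' I) (H c)) = H c) ∧
    (∀ c d : Concept I, H c = H d → c = d) ∧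
    (∀ c d : Concept I, H c ∩ H d = H (Concept.inf c d)) := by
  refine ⟨fun c => (subset_dn_up _ _).antisymm' ?_, fun c d h => ?_, fun c d => rfl⟩
  · rintro ⟨⟨d, a⟩, had⟩ ha
    have key : a ∈ dn I (up I (c.ext ∩ d.ext)) := by
      intro x hx
      refine (ha (d, x) ?_).resolve_left (not_not_intro rfl)
      rintro ⟨⟨e, b⟩, hb⟩ hbc
      by_cases hed : e = d
      · subst hed
        exact Or.inr (hx b ⟨hbc, hb⟩)
      · exact Or.inl hed
    exact ((c.inf d).dn_int ▸ key : a ∈ (c.inf d).ext).1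
  · apply Concept.ext_inj
    ext a
    constructor <;> intro ha
    · have hac : (⟨(c, a), ha⟩ : CtxA' I) ∈ H c := ha
      rwa [h] at hac
    · have had : (⟨(d, a), ha⟩ : CtxA' I) ∈ H d := ha
      rwa [← h] at had
end

section
/- Let P = (A, X, I) be a formal context with finite concept lattice P⁺, and let m₁, m₂ be mass functions on P such that N := ∑{m₁(c₁)·m₂(c₂) | c₁, c₂ ∈ P⁺, ⟦c₁ ∧ c₂⟧ ≠ ∅} ≠ 0. Then the Dempster–Shafer combination m₁⊕₂, defined by m₁⊕₂(c) = 0 if ⟦c⟧ = ∅ and m₁⊕₂(c) = (∑{m₁(c₁)·m₂(c₂) | c₁ ∧ c₂ = c})/N otherwise, is again a mass function on P: ∑_{c ∈ P⁺} m₁⊕₂(c) = 1 and m₁⊕₂(⊥) = 0 whenever ⟦⊥⟧ = ∅. -/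
open scoped Classical

open DS

theorem combine_nonneg {A X : Type} {I : A → X → Prop} [Fintype (Concept I)]
    {m₁ m₂ : Concept I → ℝ} (h₁ : ∀ c, 0 ≤ m₁ c) (h₂ : ∀ c, 0 ≤ m₂ c) (c : Concept I) :
    0 ≤ combine m₁ m₂ c := by
  have h (p : Concept I → Concept I → Prop) [∀ c₁ c₂, Decidable (p c₁ c₂)] :
      0 ≤ ∑ c₁ : Concept I, ∑ c₂ : Concept I, if p c₁ c₂ then m₁ c₁ * m₂ c₂ else 0 :=
    Finset.sum_nonneg fun c₁ _ => Finset.sum_nonneg fun c₂ _ =>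
      ite_nonneg (mul_nonneg (h₁ c₁) (h₂ c₂)) le_rfl
  exact ite_nonneg le_rfl (div_nonneg (h _) (h _))

theorem sum_combine {A X : Type} {I : A → X → Prop} [Fintype (Concept I)]
    (m₁ m₂ : Concept I → ℝ)
    (hN : (∑ c₁ : Concept I, ∑ c₂ : Concept I,
      if (Concept.inf c₁ c₂).ext ≠ ∅ then m₁ c₁ * m₂ c₂ else 0) ≠ 0) :
    ∑ c : Concept I, combine m₁ m₂ c = 1 := by
  have h : ∑ c : Concept I, (if c.ext = ∅ then 0 else ∑ c₁ : Concept I, ∑ c₂ : Concept I,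
        if Concept.inf c₁ c₂ = c then m₁ c₁ * m₂ c₂ else 0) =
      ∑ c₁ : Concept I, ∑ c₂ : Concept I,
        if (Concept.inf c₁ c₂).ext ≠ ∅ then m₁ c₁ * m₂ c₂ else 0 := by
    calc
      _ = ∑ c : Concept I, ∑ c₁ : Concept I, ∑ c₂ : Concept I,
          if Concept.inf c₁ c₂ = c then (if c.ext ≠ ∅ then m₁ c₁ * m₂ c₂ else 0) else 0 := by
        refine Finset.sum_congr rfl fun c _ => ?_
        by_cases hc : c.ext = ∅ <;> simp [hc]
      _ = _ := by
        rw [Finset.sum_comm]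
        refine Finset.sum_congr rfl fun c₁ _ => ?_
        rw [Finset.sum_comm]
        refine Finset.sum_congr rfl fun c₂ _ => ?_
        rw [Finset.sum_ite_eq, if_pos (Finset.mem_univ _)]
  rw [← div_self hN]
  nth_rw 1 [← h]
  rw [Finset.sum_div]
  refine Finset.sum_congr rfl fun c _ => ?_
  rw [combine, ite_div, zero_div]

/-- If `m₁, m₂` are mass functions on a formal context `P` with finite
concept lattice and the normalization constant `N` is nonzero, then the Dempster–Shafer
combination `m₁ ⊕ m₂` is again a mass function on `P`. -/
theorem combine_isMass
    {A X : Type} (I : A → X → Prop) [Fintype (Concept I)]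
    (m₁ m₂ : Concept I → ℝ)
    (h₁ : IsMass m₁) (h₂ : IsMass m₂)
    (hN : (∑ c₁ : Concept I, ∑ c₂ : Concept I,
      if (Concept.inf c₁ c₂).ext ≠ ∅ then m₁ c₁ * m₂ c₂ else 0) ≠ 0) :
    IsMass (combine m₁ m₂) := by
  have h0 := combine_nonneg (fun c => (h₁.1 c).1) (fun c => (h₂.1 c).1)
  have hs := sum_combine m₁ m₂ hN
  exact ⟨fun c => ⟨h0 c, hs ▸ Finset.single_le_sum (fun d _ => h0 d) (Finset.mem_univ c)⟩,
    hs, fun h => if_pos h⟩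
end
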